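/- arXiv:1501.06983 — 10 statements merged into one kernel-verified Lean document; each statement's English description precedes it below -/
import Mathlib

section
/- Every automorphism α_t fixes Z pointwise: for all t ∈ ℝ and z ∈ Z one has α_t(z) = z. Consequently every z ∈ Z lies in dom(δ) with δ(z) = 0. -/
/-- Every automorphism `α t` of the flow fixes the central subalgebra `Z`
pointwise, and consequently every `z ∈ Z` lies in the domain of the generator `δ`
with `δ z = 0` (the map `t ↦ α t z` has norm-derivative `0` at `t = 0`). -/
theorem alpha_fixes_Z_pointwise
    {A : Type*} [NormedRing A] [StarRing A] [CStarRing A] [NormedAlgebra ℂ A]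
    [CompleteSpace A] [StarModule ℂ A] [PartialOrder A] [StarOrderedRing A]
    (Z : StarSubalgebra ℂ A) (hZclosed : IsClosed (Z : Set A))
    (hZcentral : ∀ z ∈ Z, ∀ a : A, z * a = a * z)
    (τ : A →L[ℂ] A) (hτZ : ∀ a : A, τ a ∈ Z)
    (hτid : ∀ z ∈ Z, τ z = z)
    (hτmod : ∀ z ∈ Z, ∀ a : A, τ (z * a) = z * τ a)
    (hτtr : ∀ a b : A, τ (a * b) = τ (b * a))
    (hτstar : ∀ a : A, τ (star a) = star (τ a))
    (hτpos : ∀ a : A, 0 ≤ τ (star a * a))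
    (hτfaithful : ∀ a : A, τ (star a * a) = 0 → a = 0)
    (α : ℝ → A ≃⋆ₐ[ℂ] A)
    (hα0 : ∀ a : A, α 0 a = a)
    (hαadd : ∀ s t : ℝ, ∀ a : A, α (s + t) a = α s (α t a))
    (hαcont : ∀ a : A, Continuous fun t : ℝ => α t a)
    (hατ : ∀ (t : ℝ) (a : A), τ (α t a) = τ a) :
    (∀ t : ℝ, ∀ z ∈ Z, α t z = z) ∧
    (∀ z ∈ Z, HasDerivAt (fun t : ℝ => α t z) (0 : A) 0) := by
  have key : ∀ t : ℝ, ∀ z ∈ Z, α t z = z := by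
    intro t z hz
    have hz' : star z ∈ Z := star_mem hz
    have h1 : τ (star (α t z) * α t z) = star z * z := by
      rw [← map_star, ← map_mul, hατ, hτid _ (mul_mem hz' hz)]
    have h2 : τ (star z * α t z) = star z * z := by
      rw [hτmod _ hz', hατ, hτid _ hz]
    have h3 : τ (star (α t z) * z) = star z * z := by
      rw [hτtr, hτmod _ hz, hτstar, hατ, hτid _ hz, hZcentral z hz]
    have h4 : τ (star z * z) = star z * z := hτid _ (mul_mem hz' hz)
    have h5 : α t z - z = 0 := by
      apply hτfaithful
      rw [star_sub, sub_mul, mul_sub, mul_sub, map_sub, map_sub, map_sub, h1, h2, h3, h4]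
      simp
    exact sub_eq_zero.mp h5
  refine ⟨key, fun z hz => ?_⟩
  have h : (fun t : ℝ => α t z) = fun _ => z := funext fun t => key t z hz
  rw [h]
  exact hasDerivAt_const _ _
end

section
/- If a ∈ dom(δ) with δ(a) = d, then for every natural number k one has τ(aᵏ·d) = 0 and τ(d·aᵏ) = 0. -/
/-- If `a ∈ dom δ` with `δ a = d`, then `τ (a ^ k * d) = 0` and
`τ (d * a ^ k) = 0` for every natural number `k`. -/
theorem trace_pow_mul_deriv_eq_zero
    {A : Type*} [NormedRing A] [StarRing A] [CStarRing A] [NormedAlgebra ℂ A]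
    [CompleteSpace A] [StarModule ℂ A] [PartialOrder A] [StarOrderedRing A]
    (Z : StarSubalgebra ℂ A) (hZclosed : IsClosed (Z : Set A))
    (hZcentral : ∀ z ∈ Z, ∀ a : A, z * a = a * z)
    (τ : A →L[ℂ] A) (hτZ : ∀ a : A, τ a ∈ Z)
    (hτid : ∀ z ∈ Z, τ z = z)
    (hτmod : ∀ z ∈ Z, ∀ a : A, τ (z * a) = z * τ a)
    (hτtr : ∀ a b : A, τ (a * b) = τ (b * a))
    (hτstar : ∀ a : A, τ (star a) = star (τ a))
    (hτpos : ∀ a : A, 0 ≤ τ (star a * a))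
    (hτfaithful : ∀ a : A, τ (star a * a) = 0 → a = 0)
    (α : ℝ → A ≃⋆ₐ[ℂ] A)
    (hα0 : ∀ a : A, α 0 a = a)
    (hαadd : ∀ s t : ℝ, ∀ a : A, α (s + t) a = α s (α t a))
    (hαcont : ∀ a : A, Continuous fun t : ℝ => α t a)
    (hατ : ∀ (t : ℝ) (a : A), τ (α t a) = τ a)
    (a d : A) (had : HasDerivAt (fun t : ℝ => α t a) d 0) :
    ∀ k : ℕ, τ (a ^ k * d) = 0 ∧ τ (d * a ^ k) = 0 := by
  have key : ∀ n : ℕ, ∃ e : A, HasDerivAt (fun t : ℝ => (α t a) ^ (n + 1)) e 0 ∧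
      ∀ m : ℕ, τ (a ^ m * e) = ((n : ℂ) + 1) • τ (a ^ (m + n) * d) := by
    intro n
    induction n with
    | zero => exact ⟨d, by simpa using had, by intro m; simp⟩
    | succ n ih =>
      obtain ⟨e, he, hm⟩ := ih
      refine ⟨e * a + a ^ (n + 1) * d, ?_, ?_⟩
      · have h := he.mul had
        simp only [hα0] at h
        refine h.congr_of_eventuallyEq (Filter.Eventually.of_forall fun t => ?_)
        exact pow_succ _ _
      · intro m
        have h1 : τ (a ^ m * (e * a)) = τ (a ^ (m + 1) * e) := by
          rw [← mul_assoc, hτtr, ← mul_assoc, ← pow_succ']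
        rw [mul_add, map_add, h1, hm, ← mul_assoc, ← pow_add]
        have h2 : m + 1 + n = m + (n + 1) := by omega
        rw [h2]
        push_cast
        rw [add_smul ((n : ℂ) + 1), one_smul]
  intro k
  have h0 : τ (a ^ k * d) = 0 := by
    obtain ⟨e, he, hm⟩ := key k
    have h1 : HasDerivAt (fun t : ℝ => τ ((α t a) ^ (k + 1))) (τ e) 0 :=
      (τ.restrictScalars ℝ).hasFDerivAt.comp_hasDerivAt 0 he
    have h2 : (fun t : ℝ => τ ((α t a) ^ (k + 1))) = fun _ => τ (a ^ (k + 1)) := by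
      funext t
      rw [← map_pow, hατ]
    rw [h2] at h1
    have h3 : τ e = 0 := h1.unique (hasDerivAt_const _ _)
    have h4 := hm 0
    rw [pow_zero, one_mul, h3, zero_add] at h4
    exact (smul_eq_zero.mp h4.symm).resolve_left (Nat.cast_add_one_ne_zero k)
  exact ⟨h0, by rw [hτtr]; exact h0⟩
end

section
/- If a ∈ dom(δ) with δ(a) = d and ‖1 − a‖ < 1, then a is invertible in A and τ(d·a⁻¹) = 0. -/
/-- If `a ∈ dom δ` with `δ a = d` and `‖1 - a‖ < 1`, then `a` is
invertible and `τ (d * a⁻¹) = 0`. -/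
theorem trace_deriv_mul_inv_eq_zero_of_close_to_one
    {A : Type*} [NormedRing A] [StarRing A] [CStarRing A] [NormedAlgebra ℂ A]
    [CompleteSpace A] [StarModule ℂ A] [PartialOrder A] [StarOrderedRing A]
    (Z : StarSubalgebra ℂ A) (hZclosed : IsClosed (Z : Set A))
    (hZcentral : ∀ z ∈ Z, ∀ a : A, z * a = a * z)
    (τ : A →L[ℂ] A) (hτZ : ∀ a : A, τ a ∈ Z)
    (hτid : ∀ z ∈ Z, τ z = z)
    (hτmod : ∀ z ∈ Z, ∀ a : A, τ (z * a) = z * τ a)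
    (hτtr : ∀ a b : A, τ (a * b) = τ (b * a))
    (hτstar : ∀ a : A, τ (star a) = star (τ a))
    (hτpos : ∀ a : A, 0 ≤ τ (star a * a))
    (hτfaithful : ∀ a : A, τ (star a * a) = 0 → a = 0)
    (α : ℝ → A ≃⋆ₐ[ℂ] A)
    (hα0 : ∀ a : A, α 0 a = a)
    (hαadd : ∀ s t : ℝ, ∀ a : A, α (s + t) a = α s (α t a))
    (hαcont : ∀ a : A, Continuous fun t : ℝ => α t a)
    (hατ : ∀ (t : ℝ) (a : A), τ (α t a) = τ a)
    (a d : A) (had : HasDerivAt (fun t : ℝ => α t a) d 0)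
    (hnear : ‖(1 : A) - a‖ < 1) :
    IsUnit a ∧ τ (d * Ring.inverse a) = 0 := by
  obtain ⟨x, hx⟩ : ∃ x : A, x = 1 - a := ⟨_, rfl⟩
  have hxa : a = 1 - x := by rw [hx]; abel
  have hxn : ‖x‖ < 1 := by rw [hx]; exact hnear
  have hxd : HasDerivAt (fun t : ℝ => α t x) (-d) 0 := by
    have h := had.const_sub (1 : A)
    refine h.congr_of_eventuallyEq (Filter.Eventually.of_forall fun t => ?_)
    simp [hx]
  have key : ∀ n : ℕ, ∃ e : A, HasDerivAt (fun t : ℝ => α t (x ^ (n + 1))) e 0 ∧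
      ∀ k : ℕ, τ (e * x ^ k) = ((n : ℂ) + 1) • τ ((-d) * x ^ (n + k)) := by
    intro n
    induction n with
    | zero => exact ⟨-d, by simpa using hxd, fun k => by simp⟩
    | succ n ih =>
      obtain ⟨e, he, hk⟩ := ih
      refine ⟨e * x + x ^ (n + 1) * (-d), ?_, fun k => ?_⟩
      · have h := he.mul hxd
        simp only [hα0] at h
        refine h.congr_of_eventuallyEq (Filter.Eventually.of_forall fun t => ?_)
        simp [pow_succ]
      · have h1 : τ (x ^ (n + 1) * (-d) * x ^ k) = τ ((-d) * x ^ (n + 1 + k)) := by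
          rw [mul_assoc, hτtr, mul_assoc, ← pow_add, add_comm k]
        rw [add_mul, map_add, h1, mul_assoc, ← pow_succ', hk,
          show n + (k + 1) = n + 1 + k by ring]
        push_cast
        simp only [add_smul, one_smul]
  have hzero : ∀ n : ℕ, τ (d * x ^ n) = 0 := by
    intro n
    obtain ⟨e, he, hk⟩ := key n
    have h1 : HasDerivAt (fun t : ℝ => τ (α t (x ^ (n + 1)))) (τ e) 0 :=
      (τ.restrictScalars ℝ).hasFDerivAt.comp_hasDerivAt (0 : ℝ) he
    simp only [hατ] at h1
    have h2 : τ e = 0 := h1.unique (hasDerivAt_const _ _)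
    have h3 := hk 0
    simp only [pow_zero, mul_one, add_zero, h2, neg_mul, map_neg] at h3
    have h4 : ((n : ℂ) + 1) ≠ 0 := by exact_mod_cast Nat.succ_ne_zero n
    have h5 := (smul_eq_zero.mp h3.symm).resolve_left h4
    exact neg_eq_zero.mp h5
  have hu : IsUnit a := by rw [hxa]; exact isUnit_one_sub_of_norm_lt_one hxn
  refine ⟨hu, ?_⟩
  have hs : HasSum (fun n : ℕ => x ^ n) (Ring.inverse a) := by
    rw [hxa, NormedRing.inverse_one_sub x hxn]
    exact (summable_geometric_of_norm_lt_one hxn).hasSum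
  have h6 := (hs.mul_left d).mapL τ
  simp only [hzero] at h6
  exact h6.unique hasSum_zero
end

section
/- The map a ↦ τ(δ(a)·a⁻¹) is multiplicative-to-additive on invertible elements of dom(δ): if a and b are invertible elements of A, a ∈ dom(δ) with δ(a) = da, and b ∈ dom(δ) with δ(b) = db, then the product a·b lies in dom(δ) with δ(a·b) = da·b + a·db (the map t ↦ α_t(a·b) has norm-derivative da·b + a·db at 0), and τ((da·b + a·db)·(a·b)⁻¹) = τ(da·a⁻¹) + τ(db·b⁻¹). -/
/-- The map `a ↦ τ (δ a * a⁻¹)` is multiplicative-to-additive on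
invertible elements of `dom δ`. -/
theorem trace_deriv_mul_inv_additive
    {A : Type*} [NormedRing A] [StarRing A] [CStarRing A] [NormedAlgebra ℂ A]
    [CompleteSpace A] [StarModule ℂ A] [PartialOrder A] [StarOrderedRing A]
    (Z : StarSubalgebra ℂ A) (hZclosed : IsClosed (Z : Set A))
    (hZcentral : ∀ z ∈ Z, ∀ a : A, z * a = a * z)
    (τ : A →L[ℂ] A) (hτZ : ∀ a : A, τ a ∈ Z)
    (hτid : ∀ z ∈ Z, τ z = z)
    (hτmod : ∀ z ∈ Z, ∀ a : A, τ (z * a) = z * τ a)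
    (hτtr : ∀ a b : A, τ (a * b) = τ (b * a))
    (hτstar : ∀ a : A, τ (star a) = star (τ a))
    (hτpos : ∀ a : A, 0 ≤ τ (star a * a))
    (hτfaithful : ∀ a : A, τ (star a * a) = 0 → a = 0)
    (α : ℝ → A ≃⋆ₐ[ℂ] A)
    (hα0 : ∀ a : A, α 0 a = a)
    (hαadd : ∀ s t : ℝ, ∀ a : A, α (s + t) a = α s (α t a))
    (hαcont : ∀ a : A, Continuous fun t : ℝ => α t a)
    (hατ : ∀ (t : ℝ) (a : A), τ (α t a) = τ a)
    (a b da db : A) (ha : IsUnit a) (hb : IsUnit b)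
    (hda : HasDerivAt (fun t : ℝ => α t a) da 0)
    (hdb : HasDerivAt (fun t : ℝ => α t b) db 0) :
    HasDerivAt (fun t : ℝ => α t (a * b)) (da * b + a * db) 0 ∧
    τ ((da * b + a * db) * Ring.inverse (a * b)) =
      τ (da * Ring.inverse a) + τ (db * Ring.inverse b) := by
  constructor
  · have h := hda.mul hdb
    simp only [hα0] at h
    have e : (fun t : ℝ => α t (a * b)) = (fun t : ℝ => α t a) * (fun t : ℝ => α t b) := by
      funext t
      simp
    rw [e]
    exact h
  · obtain ⟨u, rfl⟩ := ha
    obtain ⟨v, rfl⟩ := hb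
    rw [← Units.val_mul, Ring.inverse_unit, Ring.inverse_unit, Ring.inverse_unit, mul_inv_rev,
      Units.val_mul, add_mul, map_add]
    have h1 : da * (v : A) * (((v⁻¹ : Aˣ) : A) * ((u⁻¹ : Aˣ) : A)) = da * ((u⁻¹ : Aˣ) : A) := by
      rw [mul_assoc, Units.mul_inv_cancel_left]
    have h2 : τ ((u : A) * db * (((v⁻¹ : Aˣ) : A) * ((u⁻¹ : Aˣ) : A)))
        = τ (db * ((v⁻¹ : Aˣ) : A)) := by
      rw [mul_assoc, hτtr, mul_assoc, mul_assoc, Units.inv_mul, mul_one]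
    rw [h1, h2]
end

section
/- The map a ↦ τ(δ(a)·a⁻¹) is locally constant on invertible elements of dom(δ): if a and b are invertible elements of A with a ∈ dom(δ), δ(a) = da, b ∈ dom(δ), δ(b) = db, and ‖b − a‖ < 1/‖a⁻¹‖, then τ(db·b⁻¹) = τ(da·a⁻¹). -/
theorem aux_ring_inverse_map {A : Type*} [Ring A] (f : A →* A) (u : Aˣ) :
    Ring.inverse (f u) = f (Ring.inverse (u : A)) := by
  have h : f (u : A) = ((Units.map f u : Aˣ) : A) := rfl
  rw [h, Ring.inverse_unit, Ring.inverse_unit]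
  simp

theorem aux_hasDerivAt_mul_inverse {A : Type*} [NormedRing A] [NormedAlgebra ℝ A]
    [CompleteSpace A] (f g : ℝ → A) (f' g' : A) (t : ℝ) (u : Aˣ) (hu : g t = u)
    (hf : HasDerivAt f f' t) (hg : HasDerivAt g g' t) :
    HasDerivAt (fun s => f s * Ring.inverse (g s))
      (f' * ((u⁻¹ : Aˣ) : A) - f t * (((u⁻¹ : Aˣ) : A) * g' * ((u⁻¹ : Aˣ) : A))) t := by
  have h1 := hasFDerivAt_ringInverse (𝕜 := ℝ) u
  rw [← hu] at h1
  have h2 := h1.comp_hasDerivAt t hg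
  have h3 := hf.mul h2
  refine h3.congr_deriv ?_
  simp [hu, sub_eq_add_neg]


/-- The map `a ↦ τ (δ a * a⁻¹)` is locally constant on invertible
elements of `dom δ`. -/
theorem trace_deriv_mul_inv_locally_constant
    {A : Type*} [NormedRing A] [StarRing A] [CStarRing A] [NormedAlgebra ℂ A]
    [CompleteSpace A] [StarModule ℂ A] [PartialOrder A] [StarOrderedRing A]
    (Z : StarSubalgebra ℂ A) (hZclosed : IsClosed (Z : Set A))
    (hZcentral : ∀ z ∈ Z, ∀ a : A, z * a = a * z)
    (τ : A →L[ℂ] A) (hτZ : ∀ a : A, τ a ∈ Z)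
    (hτid : ∀ z ∈ Z, τ z = z)
    (hτmod : ∀ z ∈ Z, ∀ a : A, τ (z * a) = z * τ a)
    (hτtr : ∀ a b : A, τ (a * b) = τ (b * a))
    (hτstar : ∀ a : A, τ (star a) = star (τ a))
    (hτpos : ∀ a : A, 0 ≤ τ (star a * a))
    (hτfaithful : ∀ a : A, τ (star a * a) = 0 → a = 0)
    (α : ℝ → A ≃⋆ₐ[ℂ] A)
    (hα0 : ∀ a : A, α 0 a = a)
    (hαadd : ∀ s t : ℝ, ∀ a : A, α (s + t) a = α s (α t a))
    (hαcont : ∀ a : A, Continuous fun t : ℝ => α t a)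
    (hατ : ∀ (t : ℝ) (a : A), τ (α t a) = τ a)
    (a b da db : A) (ha : IsUnit a) (hb : IsUnit b)
    (hda : HasDerivAt (fun t : ℝ => α t a) da 0)
    (hdb : HasDerivAt (fun t : ℝ => α t b) db 0)
    (hclose : ‖b - a‖ < 1 / ‖Ring.inverse a‖) :
    τ (db * Ring.inverse b) = τ (da * Ring.inverse a) := by

  have key : ∀ (h c dh dc : A) (u : Aˣ), c = u → HasDerivAt (fun t : ℝ => α t h) dh 0 →
      HasDerivAt (fun t : ℝ => α t c) dc 0 →
      τ (dh * ((u⁻¹ : Aˣ) : A) - h * (((u⁻¹ : Aˣ) : A) * dc * ((u⁻¹ : Aˣ) : A))) = 0 := by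
    intro h c dh dc u hc hh hdc
    have h1 := aux_hasDerivAt_mul_inverse _ _ _ _ 0 u (by simp only [hα0]; exact hc) hh hdc
    have h2 := (τ.restrictScalars ℝ).hasFDerivAt.comp_hasDerivAt (0 : ℝ) h1
    have h3 : ((τ.restrictScalars ℝ) ∘ fun s => α s h * Ring.inverse (α s c))
        = fun _ : ℝ => τ (h * Ring.inverse c) := by
      funext s
      have := aux_ring_inverse_map ((α s : A →* A)) u
      have h4 : Ring.inverse (α s c) = α s (Ring.inverse c) := by
        rw [hc]; exact this
      simp only [Function.comp, h4, ← map_mul, ContinuousLinearMap.coe_restrictScalars', hατ]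
    rw [h3] at h2
    have h5 := h2.unique (hasDerivAt_const (0 : ℝ) _)
    simpa only [hα0, ContinuousLinearMap.coe_restrictScalars'] using h5
  obtain ⟨v, rfl⟩ := ha
  rw [Ring.inverse_unit] at hclose
  have hunit : ∀ s ∈ Set.Icc (0 : ℝ) 1, ∃ u : Aˣ, (v : A) + s • (b - v) = u := by
    intro s hs
    have : ‖((v : A) + s • (b - v)) - v‖ < ‖((v⁻¹ : Aˣ) : A)‖⁻¹ := by
      rw [add_sub_cancel_left, norm_smul, Real.norm_of_nonneg hs.1, ← one_div]
      exact lt_of_le_of_lt (mul_le_of_le_one_left (norm_nonneg _) hs.2) hclose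
    exact ⟨Units.ofNearby v _ this, rfl⟩
  have hder : ∀ s ∈ Set.Icc (0 : ℝ) 1, HasDerivAt
      (fun s : ℝ => τ ((da + s • (db - da)) * Ring.inverse ((v : A) + s • (b - v)))) 0 s := by
    intro s hs
    obtain ⟨u, hu⟩ := hunit s hs
    have hl : ∀ x y : A, HasDerivAt (fun s : ℝ => x + s • y) y s := by
      intro x y
      simpa using ((hasDerivAt_id s).smul_const y).const_add x
    have h1 := aux_hasDerivAt_mul_inverse _ _ _ _ s u hu (hl da (db - da)) (hl v (b - v))
    have h2 := (τ.restrictScalars ℝ).hasFDerivAt.comp_hasDerivAt s h1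
    have hsm : ∀ (t : ℝ) (x : A), α t (s • x) = s • α t x := by
      intro t x
      rw [← Complex.coe_smul, ← Complex.coe_smul, map_smul]
    have d1 : HasDerivAt (fun t : ℝ => α t (b - v)) (db - da) 0 := by
      simpa only [map_sub] using hdb.fun_sub hda
    have d2 : HasDerivAt (fun t : ℝ => α t ((v : A) + s • (b - v))) (da + s • (db - da)) 0 := by
      simpa only [map_add, hsm] using hda.fun_add (d1.fun_const_smul s)
    have h3 := key _ _ _ _ u hu d1 d2
    have h4 : τ ((da + s • (db - da)) * (((u⁻¹ : Aˣ) : A) * (b - v) * ((u⁻¹ : Aˣ) : A)))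
        = τ ((b - v) * (((u⁻¹ : Aˣ) : A) * (da + s • (db - da)) * ((u⁻¹ : Aˣ) : A))) := by
      have := hτtr ((da + s • (db - da)) * ((u⁻¹ : Aˣ) : A)) ((b - v) * ((u⁻¹ : Aˣ) : A))
      simpa only [mul_assoc] using this
    refine h2.congr_deriv ?_
    rw [ContinuousLinearMap.coe_restrictScalars', ← h3, map_sub, map_sub, h4]
  have hc := constant_of_has_deriv_right_zero (fun s hs => (hder s hs).continuousAt.continuousWithinAt)
    (fun s hs => (hder s ⟨hs.1, hs.2.le⟩).hasDerivWithinAt) 1 (by simp)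
  simpa using hc
end

section
/- If a is an invertible element of A lying in dom(δ) with δ(a) = d, then τ(d·a⁻¹) is skew-adjoint: (τ(d·a⁻¹))* = −τ(d·a⁻¹). Equivalently, (1/(2πi))·τ(d·a⁻¹) is a self-adjoint element of Z. -/
/-- Trace of the derivative of powers. -/
theorem aux_pow {A : Type*} [NormedRing A] [StarRing A] [NormedAlgebra ℂ A]
    (τ : A →L[ℂ] A) (hτtr : ∀ a b : A, τ (a * b) = τ (b * a))
    (α : ℝ → A ≃⋆ₐ[ℂ] A) (hα0 : ∀ a : A, α 0 a = a)
    (b d : A) (hb : HasDerivAt (fun t : ℝ => α t b) d 0) (n : ℕ) :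
    ∃ D : A, HasDerivAt (fun t : ℝ => α t (b ^ (n + 1))) D 0 ∧
      ∀ c : A, Commute b c → τ (D * c) = ((n : ℂ) + 1) • τ (d * (b ^ n * c)) := by
  induction n with
  | zero => exact ⟨d, by simpa using hb, fun c _ => by simp⟩
  | succ n ih =>
    obtain ⟨D, hD, h⟩ := ih
    refine ⟨D * b + b ^ (n + 1) * d, ?_, ?_⟩
    · have := hD.mul hb
      simp only [hα0] at this
      refine this.congr_of_eventuallyEq (Filter.Eventually.of_forall fun t => ?_)
      simp only [Pi.mul_apply]
      rw [← map_mul, ← pow_succ]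
    · intro c hc
      have h1 := h (b * c) ((Commute.refl b).mul_right hc)
      have h2 : τ (b ^ (n + 1) * d * c) = τ (d * (b ^ (n + 1) * c)) := by
        rw [mul_assoc, hτtr, mul_assoc, (hc.pow_left (n + 1)).eq]
      rw [add_mul, map_add, mul_assoc, h1, h2, ← mul_assoc (b ^ n), ← pow_succ]
      push_cast
      rw [add_smul ((n : ℂ) + 1) (1 : ℂ), one_smul]

theorem aux_selfAdjoint {A : Type*} [CStarAlgebra A]
    (τ : A →L[ℂ] A) (hτtr : ∀ a b : A, τ (a * b) = τ (b * a))
    (α : ℝ → A ≃⋆ₐ[ℂ] A) (hα0 : ∀ a : A, α 0 a = a)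
    (hατ : ∀ (t : ℝ) (a : A), τ (α t a) = τ a)
    (b d e : A) (hb : HasDerivAt (fun t : ℝ => α t b) d 0) (hsa : star b = b)
    (hbe : b * e = 1) (heb : e * b = 1) : τ (d * e) = 0 := by
  have hpow : ∀ n : ℕ, τ (d * b ^ n) = 0 := by
    intro n
    obtain ⟨D, hD, h⟩ := aux_pow τ hτtr α hα0 b d hb n
    have h1 := h 1 (Commute.one_right b)
    have h2 : HasDerivAt (fun t : ℝ => τ (α t (b ^ (n + 1)))) (τ D) 0 :=
      (τ.restrictScalars ℝ).hasFDerivAt.comp_hasDerivAt 0 hD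
    simp only [hατ] at h2
    have h3 := h2.unique (hasDerivAt_const _ _)
    rw [mul_one, mul_one, h3] at h1
    exact (smul_eq_zero.mp h1.symm).resolve_left (by exact_mod_cast Nat.succ_ne_zero n)
  have hadj : ∀ x ∈ StarAlgebra.adjoin ℂ ({b} : Set A), τ (d * x) = 0 := by
    intro x hx
    have hx' : x ∈ Algebra.adjoin ℂ ({b} : Set A) := by
      have : x ∈ (StarAlgebra.adjoin ℂ ({b} : Set A)).toSubalgebra := hx
      rw [StarAlgebra.adjoin_toSubalgebra] at this
      rwa [Set.star_singleton, hsa, Set.union_self] at this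
    rw [Algebra.adjoin_singleton_eq_range_aeval] at hx'
    obtain ⟨p, rfl⟩ := hx'
    change τ (d * Polynomial.aeval b p) = 0
    rw [Polynomial.aeval_eq_sum_range, Finset.mul_sum, map_sum]
    exact Finset.sum_eq_zero fun i _ => by rw [mul_smul_comm, map_smul, hpow, smul_zero]
  have hel : ∀ x ∈ StarAlgebra.elemental ℂ b, τ (d * x) = 0 := by
    intro x hx
    have hcl : IsClosed {x : A | τ (d * x) = 0} :=
      isClosed_eq (by fun_prop) continuous_const
    have hx' : x ∈ closure ((StarAlgebra.adjoin ℂ ({b} : Set A) : StarSubalgebra ℂ A) : Set A) := hx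
    exact closure_minimal (fun y hy => hadj y hy) hcl hx'
  let b' : StarAlgebra.elemental ℂ b := ⟨b, StarAlgebra.elemental.self_mem ℂ b⟩
  have hu : IsUnit b' := by
    rw [← StarSubalgebra.coe_isUnit (hS := StarAlgebra.elemental.isClosed ℂ b)]
    exact ⟨⟨b, e, hbe, heb⟩, rfl⟩
  obtain ⟨c, hc⟩ := hu.exists_right_inv
  have hc' : b * (c : A) = 1 := congrArg Subtype.val hc
  have : e = c := left_inv_eq_right_inv heb hc'
  rw [this]
  exact hel _ c.2

/-- If `a` is invertible and `a ∈ dom δ` with `δ a = d`, then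
`τ (d * a⁻¹)` is skew-adjoint, equivalently `(1/(2πi)) • τ (d * a⁻¹)` is self-adjoint. -/
theorem trace_deriv_mul_inv_skew_adjoint
    {A : Type*} [NormedRing A] [StarRing A] [CStarRing A] [NormedAlgebra ℂ A]
    [CompleteSpace A] [StarModule ℂ A] [PartialOrder A] [StarOrderedRing A]
    (Z : StarSubalgebra ℂ A) (hZclosed : IsClosed (Z : Set A))
    (hZcentral : ∀ z ∈ Z, ∀ a : A, z * a = a * z)
    (τ : A →L[ℂ] A) (hτZ : ∀ a : A, τ a ∈ Z)
    (hτid : ∀ z ∈ Z, τ z = z)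
    (hτmod : ∀ z ∈ Z, ∀ a : A, τ (z * a) = z * τ a)
    (hτtr : ∀ a b : A, τ (a * b) = τ (b * a))
    (hτstar : ∀ a : A, τ (star a) = star (τ a))
    (hτpos : ∀ a : A, 0 ≤ τ (star a * a))
    (hτfaithful : ∀ a : A, τ (star a * a) = 0 → a = 0)
    (α : ℝ → A ≃⋆ₐ[ℂ] A)
    (hα0 : ∀ a : A, α 0 a = a)
    (hαadd : ∀ s t : ℝ, ∀ a : A, α (s + t) a = α s (α t a))
    (hαcont : ∀ a : A, Continuous fun t : ℝ => α t a)
    (hατ : ∀ (t : ℝ) (a : A), τ (α t a) = τ a)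
    (a d : A) (ha : IsUnit a)
    (had : HasDerivAt (fun t : ℝ => α t a) d 0) :
    star (τ (d * Ring.inverse a)) = - τ (d * Ring.inverse a) ∧
    IsSelfAdjoint (((2 * (Real.pi : ℂ) * Complex.I)⁻¹) • τ (d * Ring.inverse a)) := by
  letI : CStarAlgebra A := {}
  obtain ⟨u, rfl⟩ := ha
  rw [Ring.inverse_unit]
  set v : A := ((u⁻¹ : Aˣ) : A) with hv
  have huv : (u : A) * v = 1 := u.mul_inv
  have hvu : v * (u : A) = 1 := u.inv_mul
  have huv' : star v * star (u : A) = 1 := by rw [← star_mul, huv, star_one]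
  have hvu' : star (u : A) * star v = 1 := by rw [← star_mul, hvu, star_one]
  have hs : HasDerivAt (fun t : ℝ => α t (star (u : A))) (star d) 0 := by
    simpa only [map_star] using had.star
  have hb : HasDerivAt (fun t : ℝ => α t (star (u : A) * u)) (star d * u + star (u : A) * d) 0 := by
    have := hs.mul had
    simp only [hα0] at this
    refine this.congr_of_eventuallyEq (Filter.Eventually.of_forall fun t => ?_)
    simp only [Pi.mul_apply, map_mul]
  have key := aux_selfAdjoint τ hτtr α hα0 hατ (star (u : A) * u) _ (v * star v) hb
    (by simp)
    (by rw [mul_assoc, ← mul_assoc (u : A), huv, one_mul, hvu'])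
    (by rw [mul_assoc, ← mul_assoc (star v), huv', one_mul, hvu])
  have e1 : star d * u * (v * star v) = star d * star v := by
    rw [mul_assoc, ← mul_assoc (u : A), huv, one_mul]
  have e2 : τ (star (u : A) * d * (v * star v)) = τ (d * v) := by
    rw [mul_assoc, hτtr, mul_assoc, mul_assoc, huv', mul_one]
  have e3 : star (τ (d * v)) = τ (star d * star v) := by
    rw [← hτstar, star_mul, hτtr]
  rw [add_mul, map_add, e1, e2, ← e3] at key
  have hskew := eq_neg_of_add_eq_zero_left key
  refine ⟨hskew, ?_⟩
  rw [IsSelfAdjoint, star_smul, hskew, smul_neg, ← neg_smul]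
  congr 1
  simp
end

section
/- (Winding operator theorem.) Assume in addition that dom(δ) is norm-dense in A. Then there exists a unique function w from the set of invertible elements of A to Z such that: (i) w is locally constant on the invertible group A⁻¹ (in the norm topology), and (ii) whenever a is invertible and a ∈ dom(δ) with δ(a) = d, w(a) = (1/(2πi))·τ(d·a⁻¹). Moreover this w satisfies w(a·b) = w(a) + w(b) for all invertible a, b ∈ A, each value w(a) is a self-adjoint element of Z, and w(z) = 0 for every invertible z ∈ Z. -/
open Filter Topology

/-- The segment from `1` to `star u * u` consists of invertible elements. -/
lemma segment_isUnit {A : Type*} [CStarAlgebra A] [PartialOrder A] [StarOrderedRing A]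
    (u : Aˣ) (s : ℝ) (h0 : 0 ≤ s) (h1 : s ≤ 1) :
    IsUnit ((1 - s) • (1 : A) + s • (star (u : A) * (u : A))) := by
  rcases h1.lt_or_eq with h | h
  · have hp : IsStrictlyPositive ((1 - s) • (1 : A)) :=
      IsStrictlyPositive.smul (sub_pos.2 h) isStrictlyPositive_one
    exact (hp.add_nonneg (smul_nonneg h0 (star_mul_self_nonneg (u : A)))).isUnit
  · subst h
    simpa using u.isUnit.star.mul u.isUnit

/-- **Winding operator theorem.** If `dom δ` is norm-dense in `A`, there is
a unique locally constant map `w` on the invertible group of `A` agreeing with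
`(1/(2πi)) • τ (δ a * a⁻¹)` on invertible elements of `dom δ`; it is additive on products,
takes self-adjoint values in `Z`, and vanishes on invertible elements of `Z`. -/
theorem winding_operator_exists_unique
    {A : Type*} [NormedRing A] [StarRing A] [CStarRing A] [NormedAlgebra ℂ A]
    [CompleteSpace A] [StarModule ℂ A] [PartialOrder A] [StarOrderedRing A]
    (Z : StarSubalgebra ℂ A) (hZclosed : IsClosed (Z : Set A))
    (hZcentral : ∀ z ∈ Z, ∀ a : A, z * a = a * z)
    (τ : A →L[ℂ] A) (hτZ : ∀ a : A, τ a ∈ Z)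
    (hτid : ∀ z ∈ Z, τ z = z)
    (hτmod : ∀ z ∈ Z, ∀ a : A, τ (z * a) = z * τ a)
    (hτtr : ∀ a b : A, τ (a * b) = τ (b * a))
    (hτstar : ∀ a : A, τ (star a) = star (τ a))
    (hτpos : ∀ a : A, 0 ≤ τ (star a * a))
    (hτfaithful : ∀ a : A, τ (star a * a) = 0 → a = 0)
    (α : ℝ → A ≃⋆ₐ[ℂ] A)
    (hα0 : ∀ a : A, α 0 a = a)
    (hαadd : ∀ s t : ℝ, ∀ a : A, α (s + t) a = α s (α t a))
    (hαcont : ∀ a : A, Continuous fun t : ℝ => α t a)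
    (hατ : ∀ (t : ℝ) (a : A), τ (α t a) = τ a)
    (hdense : Dense {a : A | ∃ d : A, HasDerivAt (fun t : ℝ => α t a) d 0}) :
    ∃ w : Aˣ → A,
      ((∀ u : Aˣ, ∃ ε > (0 : ℝ), ∀ v : Aˣ, ‖(v : A) - (u : A)‖ < ε → w v = w u) ∧
       (∀ (u : Aˣ) (d : A), HasDerivAt (fun t : ℝ => α t (u : A)) d 0 →
          w u = ((2 * (Real.pi : ℂ) * Complex.I)⁻¹) • τ (d * ((u⁻¹ : Aˣ) : A)))) ∧
      (∀ w' : Aˣ → A,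
        ((∀ u : Aˣ, ∃ ε > (0 : ℝ), ∀ v : Aˣ, ‖(v : A) - (u : A)‖ < ε → w' v = w' u) ∧
         (∀ (u : Aˣ) (d : A), HasDerivAt (fun t : ℝ => α t (u : A)) d 0 →
            w' u = ((2 * (Real.pi : ℂ) * Complex.I)⁻¹) • τ (d * ((u⁻¹ : Aˣ) : A)))) →
        w' = w) ∧
      (∀ u v : Aˣ, w (u * v) = w u + w v) ∧
      (∀ u : Aˣ, w u ∈ Z ∧ IsSelfAdjoint (w u)) ∧
      (∀ u : Aˣ, (u : A) ∈ Z → w u = 0) := by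
  letI : CStarAlgebra A := {}
  set k : ℂ := (2 * (Real.pi : ℂ) * Complex.I)⁻¹ with hk
  -- calculus of the derivation
  have Dmul : ∀ {a b d e : A}, HasDerivAt (fun t : ℝ => α t a) d 0 →
      HasDerivAt (fun t : ℝ => α t b) e 0 →
      HasDerivAt (fun t : ℝ => α t (a * b)) (d * b + a * e) 0 := by
    intro a b d e ha hb
    have h := HasDerivAt.fun_mul ha hb
    simpa only [hα0, map_mul] using h
  have Dinv : ∀ {u : Aˣ} {d : A}, HasDerivAt (fun t : ℝ => α t (u : A)) d 0 →
      ∃ e, HasDerivAt (fun t : ℝ => α t ((u⁻¹ : Aˣ) : A)) e 0 := by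
    intro u d hd
    have h1 : HasFDerivAt Ring.inverse
        (-((ContinuousLinearMap.mulLeftRight ℝ A) ↑u⁻¹) ↑u⁻¹) (α 0 (u : A)) := by
      rw [hα0]; exact hasFDerivAt_ringInverse u
    have h2 := h1.comp_hasDerivAt (0 : ℝ) hd
    refine ⟨_, h2.congr_of_eventuallyEq (Eventually.of_forall fun t => ?_)⟩
    have h3 : α t (u : A) = ((Units.map (α t : A →* A) u : Aˣ) : A) := rfl
    simp only [Function.comp]
    rw [h3, Ring.inverse_unit, ← map_inv]
    rfl
  have Dtau : ∀ {a d : A}, HasDerivAt (fun t : ℝ => α t a) d 0 → τ d = 0 := by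
    intro a d hd
    have h1 := (τ.restrictScalars ℝ).hasFDerivAt.comp_hasDerivAt (0 : ℝ) hd
    have h2 : ((τ.restrictScalars ℝ) ∘ fun t : ℝ => α t a) = fun _ => τ a := by
      funext t; simp [hατ]
    rw [h2] at h1
    have := h1.unique (hasDerivAt_const (0 : ℝ) (τ a))
    simpa using this
  have Dpow : ∀ {x d : A}, HasDerivAt (fun t : ℝ => α t x) d 0 → ∀ n : ℕ,
      ∃ e, HasDerivAt (fun t : ℝ => α t (x ^ (n + 1))) e 0 ∧
        ∀ j : ℕ, τ (e * x ^ j) = ((n : ℂ) + 1) • τ (d * x ^ (n + j)) := by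
    intro x d hd n
    induction n with
    | zero => exact ⟨d, by simpa using hd, fun j => by simp⟩
    | succ n ih =>
      obtain ⟨e, he, hj⟩ := ih
      refine ⟨e * x + x ^ (n + 1) * d, ?_, fun j => ?_⟩
      · have := Dmul he hd
        simpa only [← pow_succ] using this
      · have e1 : τ (e * x * x ^ j) = ((n : ℂ) + 1) • τ (d * x ^ (n + 1 + j)) := by
          rw [mul_assoc, ← pow_succ', hj]
          congr 4; ring
        have e2 : τ (x ^ (n + 1) * d * x ^ j) = τ (d * x ^ (n + 1 + j)) := by
          rw [mul_assoc, hτtr, mul_assoc, ← pow_add, add_comm j]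
        rw [add_mul, map_add, e1, e2]
        push_cast
        module
  have Dpow0 : ∀ {x d : A}, HasDerivAt (fun t : ℝ => α t x) d 0 → ∀ n : ℕ,
      τ (d * x ^ n) = 0 := by
    intro x d hd n
    obtain ⟨e, he, hj⟩ := Dpow hd n
    have h := hj 0
    simp only [pow_zero, mul_one, add_zero, Dtau he] at h
    exact (smul_eq_zero.1 h.symm).resolve_left (by exact_mod_cast Nat.succ_ne_zero n)
  have Dnear : ∀ {g : Aˣ} {d : A}, HasDerivAt (fun t : ℝ => α t (g : A)) d 0 →
      ‖(g : A) - 1‖ < 1 → τ (d * ((g⁻¹ : Aˣ) : A)) = 0 := by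
    intro g d hd hg
    have hx : HasDerivAt (fun t : ℝ => α t (1 - (g : A))) (-d) 0 := by
      have := hd.const_sub (1 : A)
      simpa only [map_sub, map_one] using this
    have hn : ‖1 - (g : A)‖ < 1 := by rwa [norm_sub_rev]
    have hsum := (summable_geometric_of_norm_lt_one hn).hasSum
    have hinv : ((g⁻¹ : Aˣ) : A) = ∑' n : ℕ, (1 - (g : A)) ^ n := by
      have := geom_series_mul_neg _ hn
      rw [sub_sub_cancel] at this
      exact (Units.eq_inv_of_mul_eq_one_right this).symm
    rw [← hinv] at hsum
    have h2 := τ.hasSum (hsum.mul_left (-d))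
    have h3 : (fun n : ℕ => τ (-d * (1 - (g : A)) ^ n)) = fun _ => 0 := by
      funext n; exact Dpow0 hx n
    rw [h3] at h2
    have := h2.unique hasSum_zero
    simpa using this
  have Dadd : ∀ {u v : Aˣ} {d e : A},
      τ ((d * (v : A) + u * e) * (((u * v)⁻¹ : Aˣ) : A)) =
        τ (d * ((u⁻¹ : Aˣ) : A)) + τ (e * ((v⁻¹ : Aˣ) : A)) := by
    intro u v d e
    rw [add_mul, map_add]
    congr 1
    · simp [mul_assoc]
    · rw [mul_assoc, hτtr]
      simp [mul_assoc]
  have Dloc : ∀ {u v : Aˣ} {d e : A}, HasDerivAt (fun t : ℝ => α t (u : A)) d 0 →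
      HasDerivAt (fun t : ℝ => α t (v : A)) e 0 → ‖((u⁻¹ * v : Aˣ) : A) - 1‖ < 1 →
      τ (e * ((v⁻¹ : Aˣ) : A)) = τ (d * ((u⁻¹ : Aˣ) : A)) := by
    intro u v d e hu hv hn
    obtain ⟨f, hf⟩ := Dinv hu
    have hg := Dmul hf hv
    rw [← Units.val_mul] at hg
    have h0 := Dnear hg hn
    have hp := Dmul hu hg
    rw [← Units.val_mul, mul_inv_cancel_left] at hp
    have := @Dadd u (u⁻¹ * v) d (f * ↑v + ↑u⁻¹ * e)
    rw [mul_inv_cancel_left, h0, add_zero, ← hp.unique hv |>.symm] at this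
    exact this
  -- nearby domain elements
  have Dden : ∀ (u : Aˣ) (S : Set Aˣ), S ∈ 𝓝 u → ∃ v ∈ S, ∃ d : A,
      HasDerivAt (fun t : ℝ => α t (v : A)) d 0 := by
    intro u S hS
    have h1 : (Units.val '' S) ∈ 𝓝 (u : A) := Units.isOpenEmbedding_val.isOpenMap.image_mem_nhds hS
    obtain ⟨a, ha, hd⟩ := mem_closure_iff_nhds.1 (hdense (u : A)) _ h1
    obtain ⟨v, hv, rfl⟩ := ha
    exact ⟨v, hv, hd⟩
  have nball : ∀ (u : Aˣ) (ε : ℝ), 0 < ε → {v : Aˣ | ‖(v : A) - u‖ < ε} ∈ 𝓝 u := by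
    intro u ε hε
    have := Units.continuous_val.continuousAt (x := u) (Metric.ball_mem_nhds (u : A) hε)
    filter_upwards [this] with v hv
    simpa [dist_eq_norm] using hv
  have nball' : ∀ (u : Aˣ) (S : Set Aˣ), S ∈ 𝓝 u →
      ∃ ε > (0 : ℝ), ∀ v : Aˣ, ‖(v : A) - u‖ < ε → v ∈ S := by
    intro u S hS
    have h1 : (Units.val '' S) ∈ 𝓝 (u : A) := Units.isOpenEmbedding_val.isOpenMap.image_mem_nhds hS
    obtain ⟨ε, hε, hb⟩ := Metric.mem_nhds_iff.1 h1
    refine ⟨ε, hε, fun v hv => ?_⟩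
    obtain ⟨v', hv', h⟩ := hb (show (v : A) ∈ Metric.ball (u : A) ε by simpa [dist_eq_norm] using hv)
    rwa [← Units.ext h]
  have key : ∀ u : Aˣ, ∃ c : A, ∀ᶠ v : Aˣ in 𝓝 u, ∀ d : A,
      HasDerivAt (fun t : ℝ => α t (v : A)) d 0 → k • τ (d * ((v⁻¹ : Aˣ) : A)) = c := by
    intro u
    have hc : Continuous fun p : Aˣ × Aˣ => ‖((p.1⁻¹ * p.2 : Aˣ) : A) - 1‖ := by fun_prop
    have h1 : ∀ᶠ p in 𝓝 (u, u), ‖((p.1⁻¹ * p.2 : Aˣ) : A) - 1‖ < 1 :=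
      hc.continuousAt.eventually_lt continuousAt_const (by simp)
    rw [nhds_prod_eq] at h1
    obtain ⟨P, hP, Q, hQ, hPQ⟩ := Filter.eventually_prod_iff.1 h1
    obtain ⟨v, hv, d, hd⟩ := Dden u _ hP
    refine ⟨k • τ (d * ((v⁻¹ : Aˣ) : A)), ?_⟩
    filter_upwards [hQ] with v' hv' e he
    rw [Dloc hd he (hPQ hv hv')]
  choose w hw using key
  have wD : ∀ (u : Aˣ) (d : A), HasDerivAt (fun t : ℝ => α t (u : A)) d 0 →
      w u = k • τ (d * ((u⁻¹ : Aˣ) : A)) := fun u d hd => ((hw u).self_of_nhds d hd).symm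
  have wloc : ∀ u : Aˣ, ∀ᶠ v in 𝓝 u, w v = w u := by
    intro u
    filter_upwards [(hw u).eventually_nhds] with v hv
    obtain ⟨v', ⟨h1, h2⟩, d, hd⟩ := Dden v _ (hv.and (hw v))
    rw [← h1 d hd, ← h2 d hd]
  have wmul : ∀ u v : Aˣ, w (u * v) = w u + w v := by
    intro u v
    have hc : Continuous fun p : Aˣ × Aˣ => p.1 * p.2 := by fun_prop
    have h1 : ∀ᶠ p in 𝓝 (u, v), w (p.1 * p.2) = w (u * v) :=
      (hc.tendsto (u, v)).eventually (wloc (u * v))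
    rw [nhds_prod_eq] at h1
    obtain ⟨P, hP, Q, hQ, hPQ⟩ := Filter.eventually_prod_iff.1 h1
    obtain ⟨u', ⟨hu, hu2⟩, d, hd⟩ := Dden u _ (hP.and (wloc u))
    obtain ⟨v', ⟨hv, hv2⟩, e, he⟩ := Dden v _ (hQ.and (wloc v))
    have h3 := Dmul hd he
    rw [← Units.val_mul] at h3
    rw [← hPQ hu hv, ← hu2, ← hv2, wD _ _ hd, wD _ _ he, wD _ _ h3, Dadd, smul_add]
  have wone : w 1 = 0 := by
    have := wmul 1 1
    rw [mul_one] at this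
    simpa using this
  have wstar : ∀ u : Aˣ, w (star u) = - star (w u) := by
    intro u
    have hc : Continuous fun v : Aˣ => star v := by
      rw [Units.isOpenEmbedding_val.isInducing.continuous_iff]
      exact continuous_star.comp Units.continuous_val
    have h1 : ∀ᶠ v in 𝓝 u, w (star v) = w (star u) := hc.continuousAt.eventually (wloc (star u))
    obtain ⟨v, ⟨hv1, hv2⟩, d, hd⟩ := Dden u _ (h1.and (wloc u))
    have hs : HasDerivAt (fun t : ℝ => α t ((star v : Aˣ) : A)) (star d) 0 := by
      have := hd.star
      simpa only [Units.coe_star, map_star] using this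
    have hkk : star k = -k := by
      rw [hk]
      simp
    rw [← hv1, ← hv2, wD _ _ hd, wD _ _ hs, star_smul, hkk, ← hτstar, star_mul, hτtr, neg_smul,
      neg_neg, ← star_inv, Units.coe_star]
  have wpos : ∀ u : Aˣ, w (star u * u) = 0 := by
    intro u
    let γ : unitInterval → Aˣ := fun s => (segment_isUnit u s.1 s.2.1 s.2.2).unit
    have hγ : Continuous γ := by
      rw [Units.isOpenEmbedding_val.isInducing.continuous_iff]
      change Continuous fun s : unitInterval =>
        ((1 - s.1) • (1 : A) + s.1 • (star (u : A) * (u : A)))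
      fun_prop
    have hl : IsLocallyConstant w := (IsLocallyConstant.iff_eventually_eq w).2 wloc
    have h := (hl.comp_continuous hγ).apply_eq_of_isPreconnected isPreconnected_univ
      (Set.mem_univ (0 : unitInterval)) (Set.mem_univ (1 : unitInterval))
    have g0 : γ 0 = 1 := by
      ext; simp [γ]
    have g1 : γ 1 = star u * u := by
      ext; simp [γ]
    simp only [Function.comp, g0, g1, wone] at h
    exact h.symm
  refine ⟨w, ⟨fun u => nball' u _ (wloc u), wD⟩, ?_, wmul, ?_, ?_⟩
  · rintro w' ⟨h1, h2⟩
    funext u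
    obtain ⟨ε, hε, h⟩ := h1 u
    obtain ⟨v, ⟨hv1, hv2⟩, d, hd⟩ := Dden u _ (inter_mem (nball u ε hε) (wloc u))
    have hv2' : w v = w u := hv2
    rw [← h v hv1, ← hv2', wD v d hd, h2 v d hd]
  · intro u
    constructor
    · obtain ⟨v, hv, d, hd⟩ := Dden u _ (wloc u)
      have hv' : w v = w u := hv
      rw [← hv', wD v d hd]
      exact Z.smul_mem (hτZ _) k
    · have h := wmul (star u) u
      rw [wpos, wstar] at h
      have h' : star (w u) = w u := by
        rw [eq_comm, ← sub_eq_zero, sub_eq_add_neg, add_comm]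
        exact h.symm
      exact h'
  · intro u hu
    have hfix : ∀ t : ℝ, α t (u : A) = u := by
      intro t
      rw [← sub_eq_zero]
      apply hτfaithful
      have hsu : star (u : A) ∈ Z := star_mem hu
      have e1 : τ (star (α t (u : A)) * α t (u : A)) = star (u : A) * u := by
        rw [← map_star, ← map_mul, hατ, hτid _ (mul_mem hsu hu)]
      have e2 : τ (star (α t (u : A)) * (u : A)) = star (u : A) * u := by
        rw [hτtr, hτmod _ hu, ← map_star, hατ, hτid _ hsu, hZcentral _ hu]
      have e3 : τ (star (u : A) * α t (u : A)) = star (u : A) * u := by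
        rw [hτmod _ hsu, hατ, hτid _ hu]
      have e4 : τ (star (u : A) * (u : A)) = star (u : A) * u := hτid _ (mul_mem hsu hu)
      rw [star_sub, sub_mul, mul_sub, mul_sub, map_sub, map_sub, map_sub, e1, e2, e3, e4]
      simp
    have hd : HasDerivAt (fun t : ℝ => α t (u : A)) 0 0 := by
      simp only [hfix]
      exact hasDerivAt_const _ _
    rw [wD u 0 hd]
    simp
end

section
/- For all bounded operators A, B on ℋ with A ∘ B = B ∘ A: [T_A, T_B] = (1/2)·(P ∘ (A ∘ H ∘ B − B ∘ H ∘ A) ∘ P). -/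
/-- For an idempotent `P` with `H = 2•P - 1`, Toeplitz compressions
`T_X = P * X * P`, and commuting `A`, `B`, one has
`[T_A, T_B] = (1/2) • (P * (A*H*B - B*H*A) * P)`. -/
theorem toeplitz_commutator_eq
    {ℋ : Type*} [NormedAddCommGroup ℋ] [InnerProductSpace ℂ ℋ] [CompleteSpace ℋ]
    (P : ℋ →L[ℂ] ℋ) (hP : P * P = P) (H : ℋ →L[ℂ] ℋ) (hH : H = 2 • P - 1)
    (A B : ℋ →L[ℂ] ℋ) (hAB : A * B = B * A) :
    (P * A * P) * (P * B * P) - (P * B * P) * (P * A * P) =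
      ((1 : ℂ) / 2) • (P * (A * H * B - B * H * A) * P) := by
  have key : ∀ X Y : ℋ →L[ℂ] ℋ, (P * X * P) * (P * Y * P) = P * X * P * Y * P := by
    intro X Y
    calc (P * X * P) * (P * Y * P) = P * X * (P * P) * Y * P := by simp only [mul_assoc]
      _ = P * X * P * Y * P := by rw [hP]
  have h1 : A * H * B - B * H * A = (2 : ℂ) • (A * P * B - B * P * A) := by
    have e : A * H * B - B * H * A
        = (A * P * B - B * P * A) + (A * P * B - B * P * A) - (A * B - B * A) := by
      rw [hH, two_smul]
      noncomm_ring
    rw [e, hAB, sub_self, sub_zero, two_smul]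
  rw [key, key, h1, mul_smul_comm, smul_mul_assoc, smul_smul]
  norm_num
  simp only [mul_sub, sub_mul, mul_assoc]
end

section
/- (Winding number of the generator V under the Kronecker flow.) Fix μ ∈ ℝ. The map s ↦ α^μ_s(V) from ℝ to C(𝕋 × 𝕋, ℂ) has norm-derivative d at s = 0, where d(z, w) = −2πi·μ·w; and (1/(2πi))·∫_{𝕋×𝕋} d(z, w)·conj(w) d(haar × haar)(z, w) = −μ. That is, the winding number of V under α^μ is −μ. -/
open MeasureTheory

/-- (Winding number of the generator `V` under the Kronecker flow.)
For the Kronecker flow `(α^μ_s f)(z,w) = f (e^{-2πis}·z, e^{-2πiμs}·w)` on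
`C(𝕋 × 𝕋, ℂ)` and the generator `V (z,w) = w`, the map `s ↦ α^μ_s V` has
norm-derivative `d`, `d (z,w) = -2πi·μ·w`, at `s = 0`, and
`(1/(2πi)) ∫ d (z,w)·conj w = -μ` with respect to the Haar probability measure. -/
theorem kronecker_winding_number_of_V
    [MeasurableSpace Circle] [BorelSpace Circle]
    (μh : Measure Circle) [μh.IsHaarMeasure] [IsProbabilityMeasure μh]
    (μ : ℝ)
    (V : C(Circle × Circle, ℂ)) (hV : ∀ p : Circle × Circle, V p = (p.2 : ℂ))
    (F : ℝ → C(Circle × Circle, ℂ))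
    (hF : ∀ (s : ℝ) (p : Circle × Circle),
      F s p = V (Circle.exp (-(2 * Real.pi * s)) * p.1,
                 Circle.exp (-(2 * Real.pi * μ * s)) * p.2))
    (d : C(Circle × Circle, ℂ))
    (hd : ∀ p : Circle × Circle,
      d p = -(2 * (Real.pi : ℂ) * Complex.I) * (μ : ℂ) * (p.2 : ℂ)) :
    HasDerivAt F d 0 ∧
    (2 * (Real.pi : ℂ) * Complex.I)⁻¹ *
        ∫ p : Circle × Circle, d p * (starRingEnd ℂ) (p.2 : ℂ) ∂(μh.prod μh) =
      -(μ : ℂ) := by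
  have key : ∀ w : Circle, (w : ℂ) * (starRingEnd ℂ) (w : ℂ) = 1 := by
    intro w
    rw [Complex.mul_conj, Circle.normSq_coe, Complex.ofReal_one]
  constructor
  · have hFe : F = fun s : ℝ =>
        Complex.exp ((-(2 * (Real.pi : ℂ) * Complex.I) * (μ : ℂ)) * (s : ℂ)) • V := by
      funext s
      ext p
      rw [hF, hV, ContinuousMap.smul_apply, hV, Circle.coe_mul, Circle.coe_exp, smul_eq_mul]
      congr 2
      push_cast
      ring
    have hde : d = (-(2 * (Real.pi : ℂ) * Complex.I) * (μ : ℂ)) • V := by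
      ext p
      rw [hd, ContinuousMap.smul_apply, hV, smul_eq_mul]
    rw [hFe, hde]
    have h1 : HasDerivAt (fun s : ℂ =>
        Complex.exp ((-(2 * (Real.pi : ℂ) * Complex.I) * (μ : ℂ)) * s))
        (-(2 * (Real.pi : ℂ) * Complex.I) * (μ : ℂ)) ((0 : ℝ) : ℂ) := by
      have h := ((hasDerivAt_id (((0 : ℝ) : ℂ))).const_mul
        (-(2 * (Real.pi : ℂ) * Complex.I) * (μ : ℂ))).cexp
      simpa using h
    exact h1.comp_ofReal.smul_const V
  · have h2 : ∀ p : Circle × Circle, d p * (starRingEnd ℂ) (p.2 : ℂ) =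
        -(2 * (Real.pi : ℂ) * Complex.I) * (μ : ℂ) := by
      intro p
      rw [hd, mul_assoc, key, mul_one]
    have h3 : (2 * (Real.pi : ℂ) * Complex.I) ≠ 0 := Complex.two_pi_I_ne_zero
    simp_rw [h2]
    rw [integral_const, probReal_univ, one_smul, neg_mul, mul_neg, inv_mul_cancel_left₀ h3]
end

section
/- (Winding operator of the generator v under the generalized Kronecker flow.) Let X be a compact Hausdorff topological space and η : X → ℝ a continuous function. The map t ↦ α^η_t(v) from ℝ to C(X × 𝕋 × 𝕋, ℂ) has norm-derivative d at t = 0, where d(x, z, w) = −2πi·η(x)·w; and for every x ∈ X, (1/(2πi))·∫_{𝕋×𝕋} d(x, z, w)·conj(w) d(haar × haar)(z, w) = −η(x). That is, the winding operator of v under α^η is the element −η of C(X, ℝ). -/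
open MeasureTheory

/-- (Winding operator of the generator `v` under the generalized
Kronecker flow.) For a compact Hausdorff space `X`, a continuous `η : X → ℝ`, the flow
`(α^η_t f)(x,z,w) = f (x, e^{-2πit}·z, e^{-2πitη(x)}·w)` on `C(X × 𝕋 × 𝕋, ℂ)` and the
generator `v (x,z,w) = w`, the map `t ↦ α^η_t v` has norm-derivative `d` at `t = 0`,
where `d (x,z,w) = -2πi·η(x)·w`, and for every `x`,
`(1/(2πi)) ∫ d (x,z,w)·conj w = -η x` with respect to the Haar probability measure. -/
theorem generalized_kronecker_winding_operator_of_v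
    [MeasurableSpace Circle] [BorelSpace Circle]
    (μh : Measure Circle) [μh.IsHaarMeasure] [IsProbabilityMeasure μh]
    {X : Type*} [TopologicalSpace X] [CompactSpace X] [T2Space X]
    (η : C(X, ℝ))
    (v : C(X × Circle × Circle, ℂ)) (hv : ∀ p : X × Circle × Circle, v p = (p.2.2 : ℂ))
    (F : ℝ → C(X × Circle × Circle, ℂ))
    (hF : ∀ (t : ℝ) (p : X × Circle × Circle),
      F t p = v (p.1, Circle.exp (-(2 * Real.pi * t)) * p.2.1,
                 Circle.exp (-(2 * Real.pi * t * η p.1)) * p.2.2))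
    (d : C(X × Circle × Circle, ℂ))
    (hd : ∀ p : X × Circle × Circle,
      d p = -(2 * (Real.pi : ℂ) * Complex.I) * (η p.1 : ℂ) * (p.2.2 : ℂ)) :
    HasDerivAt F d 0 ∧
    ∀ x : X,
      (2 * (Real.pi : ℂ) * Complex.I)⁻¹ *
          ∫ q : Circle × Circle, d (x, q.1, q.2) * (starRingEnd ℂ) (q.2 : ℂ)
            ∂(μh.prod μh) =
        -(η x : ℂ) := by
  have hcc : ∀ w : Circle, (w : ℂ) * (starRingEnd ℂ) (w : ℂ) = 1 := by
    intro w
    rw [Complex.mul_conj, Circle.normSq_coe, Complex.ofReal_one]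
  constructor
  · have h1 := (hasDerivAt_exp_smul_const (𝕂 := ℝ) (d * star v) (0 : ℝ)).mul_const v
    have e1 : (fun t : ℝ => NormedSpace.exp (t • (d * star v)) * v) = F := by
      funext t
      ext p
      have h2 := NormedSpace.map_exp (ContinuousMap.evalAlgHom ℂ ℂ p)
        (continuous_eval_const p) (t • (d * star v))
      simp only [ContinuousMap.evalAlgHom_apply] at h2
      rw [ContinuousMap.mul_apply, h2, hF, hv, hv, ← Complex.exp_eq_exp_ℂ]
      simp only [Circle.coe_mul, Circle.coe_exp]
      congr 2
      simp only [ContinuousMap.smul_apply, ContinuousMap.mul_apply, ContinuousMap.star_apply,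
        hd, hv, Complex.real_smul]
      have h3 := hcc p.2.2
      rw [starRingEnd_apply] at h3
      push_cast
      linear_combination (-(t : ℂ) * 2 * Real.pi * Complex.I * η p.1) * h3
    have e2 : NormedSpace.exp ((0 : ℝ) • (d * star v)) * (d * star v) * v = d := by
      rw [zero_smul, NormedSpace.exp_zero, one_mul]
      ext p
      simp only [ContinuousMap.mul_apply, ContinuousMap.star_apply, hv]
      have h3 := hcc p.2.2
      rw [starRingEnd_apply] at h3
      linear_combination (d p) * h3
    rw [← e1]
    exact h1.congr_deriv e2
  · intro x
    have h : ∀ q : Circle × Circle, d (x, q.1, q.2) * (starRingEnd ℂ) (q.2 : ℂ) =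
        -(2 * (Real.pi : ℂ) * Complex.I) * (η x : ℂ) := by
      intro q
      rw [hd, mul_assoc, hcc, mul_one]
    simp only [h, integral_const, probReal_univ, one_smul]
    have := Complex.two_pi_I_ne_zero
    field_simp
end
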